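/- arXiv:1509.08273 — 2 statements merged into one kernel-verified Lean document; each statement's English description precedes it below -/
import Mathlib

section
/- Let B be a bounded measurable vector field on R^n whose distributional divergence is a Radon measure μ. Then |μ| is absolutely continuous with respect to the (n-1)-dimensional Hausdorff measure: if H^{n-1}(A)=0 for a Borel set A, then |μ|(A)=0. -/
open MeasureTheory Filter Topology Metric Set
open scoped ENNReal RealInnerProductSpace

/-- A diameter can be slightly enlarged to a positive radius, with control on its `m`-th power. -/
lemma exists_radius_gt (m : ℕ) {d : ℝ≥0∞} {ε : ℝ} (hε : 0 < ε) (hd : d < ENNReal.ofReal ε)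
    {δ : ℝ≥0∞} (hδ : δ ≠ 0) :
    ∃ r : ℝ, 0 < r ∧ r < ε ∧ d < ENNReal.ofReal r ∧ ENNReal.ofReal (r ^ m) ≤ d ^ m + δ := by
  have hd' : d ≠ ∞ := hd.ne_top
  have had : ENNReal.ofReal d.toReal = d := ENNReal.ofReal_toReal hd'
  have ha : d.toReal < ε := by
    rw [← had] at hd
    exact (ENNReal.ofReal_lt_ofReal_iff hε).1 hd
  have hcont : Tendsto (fun x : ℝ => ENNReal.ofReal (x ^ m)) (𝓝[>] d.toReal) (𝓝 (d ^ m)) := by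
    have h : Tendsto (fun x : ℝ => ENNReal.ofReal (x ^ m)) (𝓝 d.toReal)
        (𝓝 (ENNReal.ofReal (d.toReal ^ m))) :=
      (ENNReal.continuous_ofReal.comp (continuous_pow m)).tendsto _
    rw [ENNReal.ofReal_pow ENNReal.toReal_nonneg, had] at h
    exact h.mono_left nhdsWithin_le_nhds
  have hlt : d ^ m < d ^ m + δ := ENNReal.lt_add_right (ENNReal.pow_ne_top hd') hδ
  obtain ⟨r, hr1, hr2, hr3⟩ := ((hcont.eventually_lt_const hlt).and
    ((eventually_mem_nhdsWithin (a := d.toReal) (s := Ioi d.toReal)).and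
      (mem_nhdsWithin_of_mem_nhds (Iio_mem_nhds ha)))).exists
  have hr0 : 0 < r := ENNReal.toReal_nonneg.trans_lt hr2
  refine ⟨r, hr0, hr3, ?_, hr1.le⟩
  rw [← had]
  exact (ENNReal.ofReal_lt_ofReal_iff hr0).2 hr2

/-- A compact set with vanishing `m`-dimensional Hausdorff measure is covered by finitely many
small balls centred on it, with arbitrarily small sum of the `m`-th powers of the radii. -/
lemma exists_finite_ball_cover {X : Type*} [MetricSpace X] [MeasurableSpace X] [BorelSpace X]
    (m : ℕ) {K : Set X} (hK : IsCompact K) (hK0 : μH[(m : ℝ)] K = 0) {ε : ℝ} (hε : 0 < ε) :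
    ∃ (ι : Type) (s : Finset ι) (c : ι → X) (r : ι → ℝ),
      (∀ i, c i ∈ K ∧ 0 < r i ∧ r i < ε) ∧ K ⊆ ⋃ i ∈ s, ball (c i) (r i) ∧
        ∑ i ∈ s, r i ^ m < ε := by
  have hε2 : 0 < ENNReal.ofReal (ε / 2) := by simpa using hε
  obtain ⟨t, htK, htd, hts⟩ : ∃ t : ℕ → Set X, K ⊆ ⋃ n, t n ∧
      (∀ n, ediam (t n) ≤ ENNReal.ofReal (ε / 2)) ∧
      ∑' n, ⨆ _ : (t n).Nonempty, ediam (t n) ^ (m : ℝ) < ENNReal.ofReal (ε / 2) := by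
    rw [Measure.hausdorffMeasure_apply] at hK0
    have h := (le_iSup₂ (f := fun (r : ℝ≥0∞) (_ : 0 < r) =>
        ⨅ (t : ℕ → Set X) (_ : K ⊆ ⋃ n, t n) (_ : ∀ n, ediam (t n) ≤ r),
          ∑' n, ⨆ _ : (t n).Nonempty, ediam (t n) ^ (m : ℝ)) _ hε2).trans hK0.le
    have h' := h.trans_lt hε2
    simp only [iInf_lt_iff] at h'
    obtain ⟨t, h1, h2, h3⟩ := h'
    exact ⟨t, h1, h2, h3⟩
  let ι := {n : ℕ // (t n ∩ K).Nonempty}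
  obtain ⟨δ, hδ, hδs⟩ := ENNReal.exists_pos_sum_of_countable' hε2.ne' ι
  have hd (i : ι) : ediam (t i) < ENNReal.ofReal ε :=
    (htd i).trans_lt ((ENNReal.ofReal_lt_ofReal_iff hε).2 (half_lt_self hε))
  choose r hr0 hrε hrd hrm using fun i : ι => exists_radius_gt m hε (hd i) (hδ i).ne'
  choose c hct hcK using fun i : ι => i.2
  have hcover : K ⊆ ⋃ i, ball (c i) (r i) := by
    intro x hx
    obtain ⟨n, hn⟩ := mem_iUnion.1 (htK hx)
    let i : ι := ⟨n, x, hn, hx⟩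
    refine mem_iUnion.2 ⟨i, ?_⟩
    rw [← Metric.eball_ofReal]
    exact (edist_le_ediam_of_mem (s := t i) hn (hct i)).trans_lt (hrd i)
  obtain ⟨s, hs⟩ := hK.elim_finite_subcover _ (fun i => isOpen_ball) hcover
  refine ⟨ι, s, c, r, fun i => ⟨hcK i, hr0 i, hrε i⟩, hs, ?_⟩
  have hsum : ENNReal.ofReal (∑ i ∈ s, r i ^ m) < ENNReal.ofReal ε :=
    calc ENNReal.ofReal (∑ i ∈ s, r i ^ m)
        = ∑ i ∈ s, ENNReal.ofReal (r i ^ m) :=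
          ENNReal.ofReal_sum_of_nonneg fun i _ => pow_nonneg (hr0 i).le m
      _ ≤ ∑' i : ι, (ediam (t i) ^ m + δ i) :=
          (Finset.sum_le_sum fun i _ => hrm i).trans (ENNReal.sum_le_tsum s)
      _ = ∑' i : ι, ediam (t i) ^ m + ∑' i, δ i := ENNReal.tsum_add
      _ < ENNReal.ofReal (ε / 2) + ENNReal.ofReal (ε / 2) := by
          refine ENNReal.add_lt_add (lt_of_le_of_lt ?_ hts) hδs
          refine le_trans (ENNReal.tsum_le_tsum fun i : ι => ?_)
            (ENNReal.tsum_comp_le_tsum_of_injective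
              (f := fun i : ι => (i : ℕ)) Subtype.val_injective _)
          rw [← ENNReal.rpow_natCast]
          exact le_iSup (fun _ : (t i).Nonempty => ediam (t i) ^ (m : ℝ)) ⟨c i, hct i⟩
      _ = ENNReal.ofReal ε := by
          rw [← ENNReal.ofReal_add (by positivity) (by positivity), add_halves]
  exact (ENNReal.ofReal_lt_ofReal_iff hε).1 hsum

section Cutoff

variable {E : Type*} [NormedAddCommGroup E] [NormedSpace ℝ E]

/-- The derivative of `1 - ∏ (1 - fᵢ)`, with `0 ≤ fᵢ ≤ 1`, is bounded by the sum of the norms of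
the derivatives of the `fᵢ`. -/
lemma norm_fderiv_one_sub_prod_le {ι : Type*} (s : Finset ι) {f : ι → E → ℝ} {z : E}
    (hf : ∀ i ∈ s, DifferentiableAt ℝ (f i) z) (hf01 : ∀ i ∈ s, f i z ∈ Icc (0 : ℝ) 1) :
    ‖fderiv ℝ (fun z => 1 - ∏ i ∈ s, (1 - f i z)) z‖ ≤ ∑ i ∈ s, ‖fderiv ℝ (f i) z‖ := by
  classical
  have h := (HasFDerivAt.finsetProd (u := s) (g := fun i z => 1 - f i z)
    (g' := fun i => -fderiv ℝ (f i) z)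
    (fun i hi => (hf i hi).hasFDerivAt.const_sub 1)).const_sub 1
  rw [h.fderiv, norm_neg]
  refine (norm_sum_le _ _).trans (Finset.sum_le_sum fun i hi => ?_)
  rw [norm_smul, norm_neg]
  refine mul_le_of_le_one_left (norm_nonneg _) ?_
  rw [norm_prod]
  refine Finset.prod_le_one (fun _ _ => norm_nonneg _) fun j hj => ?_
  have := hf01 j (Finset.mem_of_mem_erase hj)
  rw [Real.norm_eq_abs, abs_le]
  constructor <;> linarith [this.1, this.2]

variable [FiniteDimensional ℝ E] [MeasurableSpace E] [BorelSpace E]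

/-- The `L¹` norm of the gradient scales with codimension one. -/
lemma integral_norm_fderiv_rescale (μ : Measure E) [μ.IsAddHaarMeasure] {m : ℕ}
    (hm : Module.finrank ℝ E = m + 1) {ψ : E → ℝ} (hψ : Differentiable ℝ ψ) (c : E) {r : ℝ}
    (hr : 0 < r) :
    ∫ z, ‖fderiv ℝ (fun z => ψ (r⁻¹ • (z - c))) z‖ ∂μ = r ^ m * ∫ z, ‖fderiv ℝ ψ z‖ ∂μ := by
  have h (z : E) : ‖fderiv ℝ (fun z => ψ (r⁻¹ • (z - c))) z‖ =
      r⁻¹ * ‖fderiv ℝ ψ (r⁻¹ • (z - c))‖ := by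
    have h1 : HasFDerivAt (fun z : E => r⁻¹ • (z - c)) (r⁻¹ • ContinuousLinearMap.id ℝ E) z :=
      ((hasFDerivAt_id z).sub_const c).const_smul r⁻¹
    have h2 := (hψ (r⁻¹ • (z - c))).hasFDerivAt.comp z h1
    rw [show (fun z => ψ (r⁻¹ • (z - c))) = ψ ∘ fun z => r⁻¹ • (z - c) from rfl, h2.fderiv,
      ContinuousLinearMap.comp_smul, ContinuousLinearMap.comp_id, norm_smul, Real.norm_eq_abs,
      abs_of_pos (inv_pos.2 hr)]
  simp_rw [h]
  rw [integral_const_mul, integral_sub_right_eq_self (fun z => ‖fderiv ℝ ψ (r⁻¹ • z)‖) c,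
    Measure.integral_comp_inv_smul_of_nonneg μ (fun z => ‖fderiv ℝ ψ z‖) hr.le, hm, smul_eq_mul,
    pow_succ]
  field_simp

/-- Cutoff functions of a compact set of vanishing codimension one Hausdorff measure, with small
support and small gradient in `L¹`. -/
lemma exists_cutoff (μ : Measure E) [μ.IsAddHaarMeasure] {m : ℕ}
    (hm : Module.finrank ℝ E = m + 1) :
    ∃ C : ℝ, ∀ K : Set E, IsCompact K → μH[(m : ℝ)] K = 0 → ∀ ε > 0, ∃ φ : E → ℝ,
      ContDiff ℝ (⊤ : ℕ∞) φ ∧ HasCompactSupport φ ∧ (∀ z, φ z ∈ Icc (0 : ℝ) 1) ∧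
        (∀ z ∈ K, φ z = 1) ∧ (∀ z, (∀ x ∈ K, 2 * ε ≤ dist z x) → φ z = 0) ∧
          ∫ z, ‖fderiv ℝ φ z‖ ∂μ ≤ C * ε := by
  let ψ : ContDiffBump (0 : E) := ⟨1, 2, one_pos, one_lt_two⟩
  have hψ : ContDiff ℝ (⊤ : ℕ∞) ψ := ψ.contDiff
  refine ⟨∫ z, ‖fderiv ℝ ψ z‖ ∂μ, fun K hK hK0 ε hε => ?_⟩
  obtain ⟨ι, s, c, r, hcr, hcov, hsum⟩ := exists_finite_ball_cover m hK hK0 hε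
  let f : ι → E → ℝ := fun i z => ψ ((r i)⁻¹ • (z - c i))
  have hf (i : ι) : ContDiff ℝ (⊤ : ℕ∞) (f i) :=
    hψ.comp ((contDiff_id.sub contDiff_const).const_smul (r i)⁻¹)
  have hf01 (i : ι) (z : E) : f i z ∈ Icc (0 : ℝ) 1 := ⟨ψ.nonneg, ψ.le_one⟩
  have hnorm (i : ι) (z : E) : ‖(r i)⁻¹ • (z - c i)‖ = dist z (c i) / r i := by
    rw [norm_smul, Real.norm_eq_abs, abs_of_pos (inv_pos.2 (hcr i).2.1), dist_eq_norm]
    field_simp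
  have hf1 (i : ι) (z : E) (hz : z ∈ ball (c i) (r i)) : f i z = 1 := by
    refine ψ.one_of_mem_closedBall ?_
    rw [mem_closedBall_zero_iff, hnorm]
    exact (div_le_one (hcr i).2.1).2 (mem_ball.1 hz).le
  have hf0 (i : ι) (z : E) (hz : 2 * r i ≤ dist z (c i)) : f i z = 0 := by
    refine ψ.zero_of_le_dist ?_
    rw [dist_zero_right, hnorm]
    exact (le_div_iff₀ (hcr i).2.1).2 hz
  have hφ0 (z : E) (hz : ∀ i ∈ s, 2 * r i ≤ dist z (c i)) : 1 - ∏ i ∈ s, (1 - f i z) = 0 := by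
    rw [Finset.prod_eq_one fun i hi => by rw [hf0 i z (hz i hi), sub_zero], sub_self]
  have hfc (i : ι) : HasCompactSupport (f i) :=
    HasCompactSupport.intro (isCompact_closedBall (c i) (2 * r i)) fun z hz =>
      hf0 i z (by simpa using (not_le.1 hz).le)
  have hφ : ContDiff ℝ (⊤ : ℕ∞) fun z => 1 - ∏ i ∈ s, (1 - f i z) :=
    contDiff_const.sub (contDiff_prod fun i _ => contDiff_const.sub (hf i))
  have hφc : HasCompactSupport fun z => 1 - ∏ i ∈ s, (1 - f i z) := by
    refine HasCompactSupport.intro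
      (s.isCompact_biUnion fun i _ => isCompact_closedBall (c i) (2 * r i)) fun z hz => ?_
    simp only [mem_iUnion, not_exists, mem_closedBall, not_le] at hz
    exact hφ0 z fun i hi => (hz i hi).le
  have hint {g : E → ℝ} (hg : ContDiff ℝ (⊤ : ℕ∞) g) (hgc : HasCompactSupport g) :
      Integrable (fun z => ‖fderiv ℝ g z‖) μ :=
    ((hg.continuous_fderiv (by simp)).integrable_of_hasCompactSupport (hgc.fderiv ℝ)).norm
  refine ⟨fun z => 1 - ∏ i ∈ s, (1 - f i z), hφ, hφc, fun z => ⟨?_, ?_⟩, fun z hz => ?_,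
    fun z hz => hφ0 z fun i hi => ?_, ?_⟩
  · exact sub_nonneg.2 (Finset.prod_le_one (fun i _ => sub_nonneg.2 (hf01 i z).2)
      fun i _ => sub_le_self _ (hf01 i z).1)
  · exact sub_le_self _ (Finset.prod_nonneg fun i _ => sub_nonneg.2 (hf01 i z).2)
  · obtain ⟨i, hi, hzi⟩ := mem_iUnion₂.1 (hcov hz)
    simp only
    rw [Finset.prod_eq_zero hi (by rw [hf1 i z hzi, sub_self]), sub_zero]
  · linarith [hz (c i) (hcr i).1, (hcr i).2.2]
  · calc ∫ z, ‖fderiv ℝ (fun z => 1 - ∏ i ∈ s, (1 - f i z)) z‖ ∂μ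
        ≤ ∫ z, ∑ i ∈ s, ‖fderiv ℝ (f i) z‖ ∂μ :=
          integral_mono (hint hφ hφc) (integrable_finsetSum _ fun i _ => hint (hf i) (hfc i))
            fun z => norm_fderiv_one_sub_prod_le s
              (fun i _ => (hf i).differentiable (by simp) z) fun i _ => hf01 i z
      _ = ∑ i ∈ s, r i ^ m * ∫ z, ‖fderiv ℝ ψ z‖ ∂μ := by
          rw [integral_finsetSum _ fun i _ => hint (hf i) (hfc i)]
          exact Finset.sum_congr rfl fun i _ =>
            integral_norm_fderiv_rescale μ hm (hψ.differentiable (by simp)) (c i) (hcr i).2.1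
      _ ≤ (∫ z, ‖fderiv ℝ ψ z‖ ∂μ) * ε := by
          rw [← Finset.sum_mul, mul_comm]
          exact mul_le_mul_of_nonneg_left hsum.le (integral_nonneg fun _ => norm_nonneg _)

end Cutoff

/-- Two mutually singular measures agreeing on the compact subsets of `A` both vanish on `A`. -/
lemma MeasureTheory.Measure.MutuallySingular.add_apply_eq_zero_of_compact
    {X : Type*} [TopologicalSpace X] [MeasurableSpace X] {p q : Measure X} [p.InnerRegular]
    [q.InnerRegular] (hpq : p ⟂ₘ q) {A : Set X} (hA : MeasurableSet A)
    (h : ∀ K ⊆ A, IsCompact K → p K = q K) : (p + q) A = 0 := by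
  have key {p q : Measure X} [p.InnerRegular] (hpq : p ⟂ₘ q)
      (h : ∀ K ⊆ A, IsCompact K → p K = q K) : p A = 0 := by
    obtain ⟨s, hs, hps, hqs⟩ := hpq
    by_contra hne
    have hlt : 0 < p (A ∩ sᶜ) := by
      rw [← sdiff_eq, measure_sdiff_null hps]
      exact pos_iff_ne_zero.2 hne
    obtain ⟨K, hKA, hK, hpK⟩ := (hA.inter hs.compl).exists_lt_isCompact hlt
    rw [h K (hKA.trans inter_subset_left) hK,
      measure_mono_null (hKA.trans inter_subset_right) hqs] at hpK
    exact lt_irrefl _ hpK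
  rw [Measure.add_apply, key hpq h, key hpq.symm fun K hKA hK => (h K hKA hK).symm, add_zero]

/-- If continuous cutoffs `φ k` concentrate on the compact set `K`, their integrals against a finite
measure converge to the measure of `K`. -/
lemma tendsto_integral_cutoff {X : Type*} [MetricSpace X] [MeasurableSpace X] [BorelSpace X]
    (p : Measure X) [IsFiniteMeasure p] {K : Set X} (hK : IsCompact K) {φ : ℕ → X → ℝ}
    {ε : ℕ → ℝ} (hε : Tendsto ε atTop (𝓝 0)) (hφ : ∀ k, Continuous (φ k))
    (hφ01 : ∀ k z, φ k z ∈ Icc (0 : ℝ) 1) (hφ1 : ∀ k, ∀ z ∈ K, φ k z = 1)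
    (hφ0 : ∀ k z, (∀ x ∈ K, ε k ≤ dist z x) → φ k z = 0) :
    Tendsto (fun k => ∫ z, φ k z ∂p) atTop (𝓝 (p.real K)) := by
  have hlim : ∫ z, K.indicator (fun _ => (1 : ℝ)) z ∂p = p.real K := by
    rw [integral_indicator hK.measurableSet]
    simp
  rw [← hlim]
  refine tendsto_integral_of_dominated_convergence (fun _ => 1)
    (fun k => (hφ k).measurable.aestronglyMeasurable) (integrable_const 1)
    (fun k => ae_of_all _ fun z => ?_) (ae_of_all _ fun z => ?_)
  · rw [Real.norm_eq_abs, abs_of_nonneg (hφ01 k z).1]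
    exact (hφ01 k z).2
  · by_cases hz : z ∈ K
    · simp [hz, hφ1]
    · rw [indicator_of_notMem hz]
      obtain ⟨δ, hδ, hball⟩ := Metric.isOpen_iff.1 hK.isClosed.isOpen_compl z hz
      refine tendsto_const_nhds.congr' ?_
      filter_upwards [hε.eventually_lt_const hδ] with k hk
      refine (hφ0 k z fun x hx => ?_).symm
      by_contra! hlt
      exact hball (mem_ball'.2 (hlt.trans hk)) hx

/-- If `B` is a bounded measurable vector field on `ℝⁿ` whose distributional
divergence is a (signed) Radon measure `μ`, then `|μ| ≪ H^{n-1}`: any Borel set of vanishing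
`(n-1)`-dimensional Hausdorff measure is `|μ|`-null. -/
theorem stmt0 {n : ℕ}
    (B : EuclideanSpace ℝ (Fin n) → EuclideanSpace ℝ (Fin n))
    (hBmeas : Measurable B) (hBbdd : ∃ C : ℝ, ∀ z, ‖B z‖ ≤ C)
    (μ : SignedMeasure (EuclideanSpace ℝ (Fin n)))
    (hdiv : ∀ φ : EuclideanSpace ℝ (Fin n) → ℝ, ContDiff ℝ (⊤ : ℕ∞) φ → HasCompactSupport φ →
      ∫ z, ⟪B z, gradient φ z⟫ =
        -((∫ z, φ z ∂(μ.toJordanDecomposition.posPart)) -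
          (∫ z, φ z ∂(μ.toJordanDecomposition.negPart)))) :
    ∀ A : Set (EuclideanSpace ℝ (Fin n)), MeasurableSet A →
      μH[(n : ℝ) - 1] A = 0 → μ.totalVariation A = 0 := by
  intro A hA hA0
  obtain _ | m := n
  · obtain rfl | ⟨x, hx⟩ := A.eq_empty_or_nonempty
    · exact measure_empty
    · have h0 : μH[(0 : ℝ)] ({x} : Set (EuclideanSpace ℝ (Fin 0))) = 0 :=
        le_antisymm ((Measure.hausdorffMeasure_mono (by simp) _).trans
          ((measure_mono (singleton_subset_iff.2 hx)).trans hA0.le)) zero_le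
      rw [Measure.hausdorffMeasure_zero_singleton] at h0
      exact absurd h0 one_ne_zero
  obtain ⟨M, hM⟩ := hBbdd
  obtain ⟨C, hC⟩ := exists_cutoff (volume : Measure (EuclideanSpace ℝ (Fin (m + 1)))) (m := m)
    (by simp)
  refine μ.toJordanDecomposition.mutuallySingular.add_apply_eq_zero_of_compact hA
    fun K hKA hK => ?_
  have hK0 : μH[(m : ℝ)] K = 0 := by
    have h := measure_mono_null hKA hA0
    rwa [Nat.cast_succ, add_sub_cancel_right] at h
  choose φ hφ hφc hφ01 hφ1 hφ0 hφC using fun k : ℕ =>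
    hC K hK hK0 (1 / ((k : ℝ) + 1)) Nat.one_div_pos_of_nat
  have hε : Tendsto (fun k : ℕ => 1 / ((k : ℝ) + 1)) atTop (𝓝 0) :=
    tendsto_one_div_add_atTop_nhds_zero_nat
  have hε2 : Tendsto (fun k : ℕ => 2 * (1 / ((k : ℝ) + 1))) atTop (𝓝 0) := by
    simpa using hε.const_mul 2
  have hlim (p : Measure (EuclideanSpace ℝ (Fin (m + 1)))) [IsFiniteMeasure p] :=
    tendsto_integral_cutoff p hK hε2 (fun k => (hφ k).continuous) hφ01 hφ1 hφ0
  have hM0 : 0 ≤ M := (norm_nonneg _).trans (hM 0)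
  have hgrad : Tendsto (fun k => ∫ z, ⟪B z, gradient (φ k) z⟫) atTop (𝓝 0) := by
    have hbound : Tendsto (fun k : ℕ => M * (C * (1 / ((k : ℝ) + 1)))) atTop (𝓝 0) := by
      simpa using (hε.const_mul C).const_mul M
    refine squeeze_zero_norm (fun k => ?_) hbound
    have hint : Integrable fun z => ‖fderiv ℝ (φ k) z‖ :=
      (((hφ k).continuous_fderiv (by simp)).integrable_of_hasCompactSupport
        ((hφc k).fderiv ℝ)).norm
    calc ‖∫ z, ⟪B z, gradient (φ k) z⟫‖ ≤ ∫ z, M * ‖fderiv ℝ (φ k) z‖ := by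
          refine norm_integral_le_of_norm_le (hint.const_mul M) (ae_of_all _ fun z => ?_)
          refine (norm_inner_le_norm _ _).trans ?_
          rw [gradient, LinearIsometryEquiv.norm_map]
          exact mul_le_mul_of_nonneg_right (hM z) (norm_nonneg _)
      _ ≤ M * (C * (1 / ((k : ℝ) + 1))) := by
          rw [integral_const_mul]
          exact mul_le_mul_of_nonneg_left (hφC k) hM0
  have hdiff := ((hlim μ.toJordanDecomposition.posPart).sub
    (hlim μ.toJordanDecomposition.negPart)).neg
  have heq := tendsto_nhds_unique hgrad
    (hdiff.congr fun k => (hdiv (φ k) (hφ k) (hφc k)).symm)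
  rw [← measureReal_eq_measureReal_iff]
  linarith
end

section
/- Let B ∈ L^∞(R^n, R^n) with Div B a Radon measure, let J be an oriented H^{n-1}-rectifiable set, and suppose at some point z_0 ∈ J the set of blow-up traces Γ_{B,J}(z_0) contains two pairs (B^-_1, B^+_1) and (B^-_2, B^+_2). Then (B^+_1 − B^-_1)·ν(z_0) = (B^+_2 − B^-_2)·ν(z_0), provided z_0 is a point where the rescaled measures of Div B away from J vanish at order r^{n-1} and the density of Div B on J has a Lebesgue point. In particular, the jump of the normal component of the traces is uniquely determined. -/
open MeasureTheory Filter Topology Metric Set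
open scoped ENNReal RealInnerProductSpace

/-- Blow-up trace pairs of `B` at `z₀` (see `traceSet` in the trace lemma). -/
noncomputable def traceSet {n : ℕ} {F : Type*} [NormedAddCommGroup F]
    (B : EuclideanSpace ℝ (Fin n) → F)
    (ν : EuclideanSpace ℝ (Fin n) → EuclideanSpace ℝ (Fin n))
    (z₀ : EuclideanSpace ℝ (Fin n)) : Set (F × F) :=
  {p | ∃ r : ℕ → ℝ, (∀ k, 0 < r k) ∧ Tendsto r atTop (𝓝 0) ∧
    ∀ R > 0, Tendsto
      (fun k => ∫ z in Metric.ball z₀ R,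
        ‖B (z₀ + r k • (z - z₀)) - (if 0 ≤ ⟪z - z₀, ν z₀⟫ then p.2 else p.1)‖)
      atTop (𝓝 0)}

def RectifiableSet {n : ℕ} (J : Set (EuclideanSpace ℝ (Fin n))) : Prop :=
  ∃ f : ℕ → EuclideanSpace ℝ (Fin (n - 1)) → EuclideanSpace ℝ (Fin n),
    (∀ i, ContDiff ℝ 1 (f i)) ∧
    μH[(n : ℝ) - 1] (J \ ⋃ i, Set.range (f i)) = 0

open scoped Convolution in
/-- If the derivative of every test function in the direction `d` has zero mean over a half-space,
then `d` is tangent to its boundary hyperplane. -/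
theorem inner_eq_zero_of_setIntegral_halfspace_fderiv_eq_zero {E : Type*} [NormedAddCommGroup E]
    [InnerProductSpace ℝ E] [FiniteDimensional ℝ E] [MeasurableSpace E] [BorelSpace E]
    {d v : E} (hv : ‖v‖ = 1)
    (h : ∀ φ : E → ℝ, ContDiff ℝ (⊤ : ℕ∞) φ → HasCompactSupport φ →
      ∫ z in {z : E | 0 ≤ ⟪z, v⟫}, fderiv ℝ φ z d = 0) :
    ⟪d, v⟫ = 0 := by
  by_contra hd
  have hvv : ⟪v, v⟫ = 1 := by rw [real_inner_self_eq_norm_sq, hv]; norm_num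
  set H : Set E := {z : E | 0 ≤ ⟪z, v⟫}
  have hH : MeasurableSet H :=
    (isClosed_le continuous_const (by fun_prop)).measurableSet
  let ψ : ContDiffBump (-v) := ⟨1 / 2, 1, by norm_num, by norm_num⟩
  let L : ℝ →L[ℝ] ℝ →L[ℝ] ℝ := ContinuousLinearMap.lsmul ℝ ℝ
  let f : E → ℝ := H.indicator fun _ => 1
  have hf : LocallyIntegrable f volume := (locallyIntegrable_const 1).indicator hH
  have hψc : ContDiff ℝ 1 ψ := ψ.contDiff
  have hconv (x : E) (g : E → ℝ) : (f ⋆[L, volume] g) x = ∫ t in H, g (x - t) := by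
    rw [← integral_indicator hH, convolution_def]
    refine integral_congr_ae (.of_forall fun t => ?_)
    by_cases ht : t ∈ H <;> simp [f, L, ht]
  have hline (s : ℝ) :
      HasDerivAt (fun s : ℝ => (f ⋆[L, volume] (ψ : E → ℝ)) (s • d)) 0 s := by
    have h1 := (ψ.hasCompactSupport.hasFDerivAt_convolution_right L hf hψc (s • d))
    have h2 := h1.comp_hasDerivAt s ((hasDerivAt_id s).smul_const d)
    refine h2.congr_deriv ?_
    rw [one_smul, convolution_precompR_apply L hf (ψ.hasCompactSupport.fderiv ℝ)
      (hψc.continuous_fderiv one_ne_zero), hconv]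
    have h3 := h (fun t => ψ (s • d - t)) (ψ.contDiff.comp (by fun_prop))
      (ψ.hasCompactSupport.comp_homeomorph (Homeomorph.subLeft (s • d)))
    have h4 (t : E) : fderiv ℝ (fun t => ψ (s • d - t)) t d = -fderiv ℝ ψ (s • d - t) d := by
      have hi : HasFDerivAt (fun t => s • d - t) (-ContinuousLinearMap.id ℝ E) t :=
        (hasFDerivAt_id t).const_sub (s • d)
      have hc := ((hψc.differentiable one_ne_zero (s • d - t)).hasFDerivAt.comp t hi).fderiv
      simp only [Function.comp_def] at hc
      simp [hc]
    simp_rw [h4] at h3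
    rw [integral_neg] at h3
    linarith
  have hconst := is_const_of_deriv_eq_zero (fun s => (hline s).differentiableAt)
    (fun s => (hline s).deriv) 0 (-(2 / ⟪d, v⟫))
  simp only [hconv] at hconst
  have hzero : ∫ t in H, ψ ((-(2 / ⟪d, v⟫)) • d - t) = 0 := by
    refine setIntegral_eq_zero_of_forall_eq_zero fun t ht => ψ.zero_of_le_dist ?_
    have ht' : 0 ≤ ⟪t, v⟫ := ht
    rw [dist_eq_norm]
    have hle := abs_real_inner_le_norm ((-(2 / ⟪d, v⟫)) • d - t - -v) v
    rw [hv, mul_one] at hle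
    refine le_trans ?_ hle
    simp only [inner_sub_left, inner_neg_left, real_inner_smul_left, hvv]
    have : -(2 / ⟪d, v⟫) * ⟪d, v⟫ = -2 := by field_simp
    rw [this, le_abs]
    right
    change 1 ≤ _
    linarith
  have hfull : ∫ t in H, ψ ((0 : ℝ) • d - t) = ∫ t, ψ t := by
    rw [setIntegral_eq_integral_of_forall_compl_eq_zero, integral_sub_left_eq_self]
    intro t ht
    refine ψ.zero_of_le_dist ?_
    have ht' : ⟪t, v⟫ < 0 := not_le.mp ht
    rw [dist_eq_norm]
    have hle := abs_real_inner_le_norm ((0 : ℝ) • d - t - -v) v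
    rw [hv, mul_one] at hle
    refine le_trans ?_ hle
    simp only [inner_sub_left, inner_neg_left, real_inner_smul_left, hvv]
    rw [le_abs]
    left
    change 1 ≤ _
    linarith
  have hpos : 0 < ∫ t, ψ t := ψ.integral_pos
  rw [hfull, hzero] at hconst
  exact hpos.ne' hconst

/-- The derivative of a compactly supported function has zero mean. -/
theorem integral_fderiv_apply_eq_zero {E : Type*} [NormedAddCommGroup E]
    [NormedSpace ℝ E] [FiniteDimensional ℝ E] [MeasurableSpace E] [BorelSpace E]
    {μ : Measure E} [μ.IsAddHaarMeasure]
    {φ : E → ℝ} (hφ : ContDiff ℝ 1 φ) (hφc : HasCompactSupport φ) (d : E) :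
    ∫ z, fderiv ℝ φ z d ∂μ = 0 := by
  have hc : Continuous fun z => fderiv ℝ φ z d := (hφ.continuous_fderiv one_ne_zero).clm_apply continuous_const
  have hcs : HasCompactSupport fun z => fderiv ℝ φ z d := hφc.fderiv_apply ℝ d
  have := integral_mul_fderiv_eq_neg_fderiv_mul_of_integrable (μ := μ)
    (f := fun _ : E => (1 : ℝ)) (g := φ) (v := d) (by simp)
    (by simpa using hc.integrable_of_hasCompactSupport hcs)
    (by simpa using hφ.continuous.integrable_of_hasCompactSupport hφc)
    (fun _ _ => differentiableAt_const _) (fun x _ => hφ.differentiable one_ne_zero x)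
  simpa using this

theorem gradient_comp_smul_sub {E : Type*} [NormedAddCommGroup E]
    [InnerProductSpace ℝ E] [CompleteSpace E] {φ : E → ℝ} (hφ : Differentiable ℝ φ) (c : ℝ)
    (z₀ z : E) :
    gradient (fun z => φ (c • (z - z₀))) z = c • gradient φ (c • (z - z₀)) := by
  refine HasGradientAt.gradient ?_
  rw [hasGradientAt_iff_hasFDerivAt]
  have h1 := (hφ (c • (z - z₀))).hasGradientAt.hasFDerivAt
  have h2 : HasFDerivAt (fun z => c • (z - z₀)) (c • ContinuousLinearMap.id ℝ E) z :=
    ((hasFDerivAt_id z).sub_const z₀).const_smul c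
  refine (h1.comp z h2).congr_fderiv ?_
  ext y
  simp

theorem continuous_gradient {E : Type*} [NormedAddCommGroup E]
    [InnerProductSpace ℝ E] [CompleteSpace E] {φ : E → ℝ} (hφ : ContDiff ℝ 1 φ) :
    Continuous (gradient φ) :=
  (InnerProductSpace.toDual ℝ E).symm.continuous.comp (hφ.continuous_fderiv one_ne_zero)

theorem HasCompactSupport.gradient {E : Type*} [NormedAddCommGroup E]
    [InnerProductSpace ℝ E] [CompleteSpace E] {φ : E → ℝ} (hφ : HasCompactSupport φ) :
    HasCompactSupport (gradient φ) :=
  (hφ.fderiv ℝ).comp_left (map_zero (InnerProductSpace.toDual ℝ E).symm)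

/-- Scaling of the pairing of a vector field with the gradient of a test function. -/
theorem integral_inner_gradient_comp_smul_sub {n : ℕ}
    (B : EuclideanSpace ℝ (Fin n) → EuclideanSpace ℝ (Fin n))
    {φ : EuclideanSpace ℝ (Fin n) → ℝ} (hφ : Differentiable ℝ φ)
    (z₀ : EuclideanSpace ℝ (Fin n)) {r : ℝ} (hr : 0 < r) :
    r ^ ((1 : ℝ) - n) * ∫ z, ⟪B z, gradient (fun z => φ (r⁻¹ • (z - z₀))) z⟫ =
      ∫ z, ⟪B (z₀ + r • (z - z₀)), gradient φ (z - z₀)⟫ := by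
  have h1 : (fun z => ⟪B z, gradient (fun z => φ (r⁻¹ • (z - z₀))) z⟫) = fun z =>
      (fun w => r⁻¹ * ⟪B (z₀ + r • w), gradient φ w⟫) (r⁻¹ • (z - z₀)) := by
    funext z
    simp [gradient_comp_smul_sub hφ, inner_smul_right, hr.ne']
  rw [h1, integral_sub_right_eq_self (fun z => (fun w => r⁻¹ * ⟪B (z₀ + r • w), gradient φ w⟫)
      (r⁻¹ • z)), Measure.integral_comp_smul volume
      (fun w => r⁻¹ * ⟪B (z₀ + r • w), gradient φ w⟫), integral_const_mul,
    integral_sub_right_eq_self (fun z => ⟪B (z₀ + r • z), gradient φ z⟫)]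
  rw [finrank_euclideanSpace_fin, inv_pow, inv_inv, abs_of_pos (by positivity), smul_eq_mul,
    Real.rpow_sub hr, Real.rpow_one, Real.rpow_natCast]
  field_simp

/-- Blow-up pairings along a sequence realizing a trace pair converge to the pairing with the
piecewise constant field. -/
theorem tendsto_integral_inner_of_tendsto_setIntegral_norm_sub {n : ℕ}
    {z₀ : EuclideanSpace ℝ (Fin n)}
    {F : ℕ → EuclideanSpace ℝ (Fin n) → EuclideanSpace ℝ (Fin n)}
    {P g : EuclideanSpace ℝ (Fin n) → EuclideanSpace ℝ (Fin n)}
    (hF : ∀ k, Measurable (F k)) (hFb : ∃ C : ℝ, ∀ k z, ‖F k z‖ ≤ C)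
    (hP : Measurable P) (hPb : ∃ C : ℝ, ∀ z, ‖P z‖ ≤ C)
    (hg : Continuous g) (hgc : HasCompactSupport g)
    (h : ∀ R > 0, Tendsto (fun k => ∫ z in ball z₀ R, ‖F k z - P z‖) atTop (𝓝 0)) :
    Tendsto (fun k => ∫ z, ⟪F k z, g z⟫) atTop (𝓝 (∫ z, ⟪P z, g z⟫)) := by
  obtain ⟨C, hC⟩ := hFb
  obtain ⟨D, hD⟩ := hPb
  obtain ⟨M, hM⟩ := hg.bounded_above_of_compact_support hgc
  obtain ⟨R, hR0, hR⟩ := hgc.isCompact.isBounded.subset_ball_lt 0 z₀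
  have hgi : Integrable g := hg.integrable_of_hasCompactSupport hgc
  have hint (G : EuclideanSpace ℝ (Fin n) → EuclideanSpace ℝ (Fin n)) (hG : Measurable G)
      (K : ℝ) (hK : ∀ z, ‖G z‖ ≤ K) : Integrable fun z => ⟪G z, g z⟫ := by
    refine (hgi.norm.const_mul K).mono'
      (hG.inner hg.measurable).aestronglyMeasurable (.of_forall fun z => ?_)
    exact (norm_inner_le_norm _ _).trans (by gcongr; exact hK z)
  rw [tendsto_iff_norm_sub_tendsto_zero]
  have hlim : Tendsto (fun k => M * ∫ z in ball z₀ R, ‖F k z - P z‖) atTop (𝓝 0) := by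
    simpa using (h R hR0).const_mul M
  refine squeeze_zero (fun _ => norm_nonneg _) (fun k => ?_) hlim
  rw [← integral_sub (hint _ (hF k) C (hC k)) (hint _ hP D hD), ← integral_const_mul]
  have hsupp : ∀ z ∉ ball z₀ R, ⟪F k z, g z⟫ - ⟪P z, g z⟫ = 0 := fun z hz => by
    simp [image_eq_zero_of_notMem_tsupport fun hz' => hz (hR hz')]
  rw [← setIntegral_eq_integral_of_forall_compl_eq_zero hsupp]
  refine norm_integral_le_of_norm_le ?_ (.of_forall fun z => ?_)
  · refine Integrable.const_mul (Integrable.norm ?_) M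
    refine Integrable.mono' (g := fun _ => C + D) (integrableOn_const measure_ball_lt_top.ne)
      ((hF k).sub hP).aestronglyMeasurable (.of_forall fun z => ?_)
    exact (norm_sub_le _ _).trans (add_le_add (hC k z) (hD z))
  · rw [← inner_sub_left, mul_comm]
    exact (norm_inner_le_norm _ _).trans (by gcongr; exact hM z)

/-- The pairing of a field which is constant on each side of a hyperplane with the gradient of a
test function only sees the jump of the field. -/
theorem integral_inner_ite_gradient {n : ℕ} (a b v : EuclideanSpace ℝ (Fin n))
    {φ : EuclideanSpace ℝ (Fin n) → ℝ} (hφ : ContDiff ℝ 1 φ) (hφc : HasCompactSupport φ) :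
    ∫ z, ⟪if 0 ≤ ⟪z, v⟫ then a else b, gradient φ z⟫ =
      ∫ z in {z | 0 ≤ ⟪z, v⟫}, fderiv ℝ φ z (a - b) := by
  have hH : MeasurableSet {z : EuclideanSpace ℝ (Fin n) | 0 ≤ ⟪z, v⟫} :=
    (isClosed_le continuous_const (by fun_prop)).measurableSet
  have hint (d : EuclideanSpace ℝ (Fin n)) : Integrable fun z => fderiv ℝ φ z d :=
    ((hφ.continuous_fderiv one_ne_zero).clm_apply continuous_const).integrable_of_hasCompactSupport
      (hφc.fderiv_apply ℝ d)
  have hsum := integral_add ((hint (a - b)).indicator hH) (hint b)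
  rw [integral_fderiv_apply_eq_zero hφ hφc b, add_zero, integral_indicator hH] at hsum
  rw [← hsum]
  refine integral_congr_ae (.of_forall fun z => ?_)
  by_cases hz : 0 ≤ ⟪z, v⟫ <;> simp [hz, inner_gradient_right]

/-- Let `B ∈ L^∞` with `Div B = μ` a Radon measure and let `J` be an oriented
rectifiable set.  At a point `z₀ ∈ J` at which the blow-ups of `μ` converge, at scale `r^{n-1}`,
to a multiple of `H^{n-1}` on the tangent hyperplane (this encodes both that the part of `μ`
away from `J` vanishes at order `r^{n-1}` and that the density of `μ` on `J` has a Lebesgue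
point at `z₀`), any two blow-up trace pairs of `B` have the same jump of the normal component. -/
theorem stmt2 {n : ℕ}
    (B : EuclideanSpace ℝ (Fin n) → EuclideanSpace ℝ (Fin n))
    (hBmeas : Measurable B) (hBbdd : ∃ C : ℝ, ∀ z, ‖B z‖ ≤ C)
    (μ : SignedMeasure (EuclideanSpace ℝ (Fin n)))
    (hdiv : ∀ φ : EuclideanSpace ℝ (Fin n) → ℝ, ContDiff ℝ (⊤ : ℕ∞) φ → HasCompactSupport φ →
      ∫ z, ⟪B z, gradient φ z⟫ =
        -((∫ z, φ z ∂(μ.toJordanDecomposition.posPart)) -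
          (∫ z, φ z ∂(μ.toJordanDecomposition.negPart))))
    (J : Set (EuclideanSpace ℝ (Fin n))) (hJ : RectifiableSet J)
    (ν : EuclideanSpace ℝ (Fin n) → EuclideanSpace ℝ (Fin n))
    (z₀ : EuclideanSpace ℝ (Fin n)) (hz₀ : z₀ ∈ J) (hν : ‖ν z₀‖ = 1)
    (hblow : ∃ c : ℝ, ∀ φ : EuclideanSpace ℝ (Fin n) → ℝ,
      ContDiff ℝ (⊤ : ℕ∞) φ → HasCompactSupport φ →
      Tendsto (fun r : ℝ => r ^ ((1 : ℝ) - n) *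
          ((∫ z, φ (r⁻¹ • (z - z₀)) ∂(μ.toJordanDecomposition.posPart)) -
            (∫ z, φ (r⁻¹ • (z - z₀)) ∂(μ.toJordanDecomposition.negPart))))
        (𝓝[>] 0)
        (𝓝 (c * ∫ z in {z : EuclideanSpace ℝ (Fin n) | ⟪z, ν z₀⟫ = 0}, φ z
              ∂(μH[(n : ℝ) - 1])))) :
    ∀ p ∈ traceSet B ν z₀, ∀ q ∈ traceSet B ν z₀,
      ⟪p.2 - p.1, ν z₀⟫ = ⟪q.2 - q.1, ν z₀⟫ := by
  obtain ⟨C, hC⟩ := hBbdd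
  obtain ⟨c, hc⟩ := hblow
  have hHm : MeasurableSet {z : EuclideanSpace ℝ (Fin n) | 0 ≤ ⟪z - z₀, ν z₀⟫} :=
    (isClosed_le continuous_const (by fun_prop)).measurableSet
  have key : ∀ p ∈ traceSet B ν z₀, ∀ φ : EuclideanSpace ℝ (Fin n) → ℝ,
      ContDiff ℝ (⊤ : ℕ∞) φ → HasCompactSupport φ →
      ∫ z in {z | 0 ≤ ⟪z, ν z₀⟫}, fderiv ℝ φ z (p.2 - p.1) =
        -(c * ∫ z in {z : EuclideanSpace ℝ (Fin n) | ⟪z, ν z₀⟫ = 0}, φ z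
          ∂(μH[(n : ℝ) - 1])) := by
    rintro p ⟨r, hr, hr0, hlim⟩ φ hφ hφc
    have hφ1 : ContDiff ℝ 1 φ := hφ.of_le (by exact_mod_cast le_top)
    have hpair := tendsto_integral_inner_of_tendsto_setIntegral_norm_sub
      (F := fun k z => B (z₀ + r k • (z - z₀)))
      (P := fun z => if 0 ≤ ⟪z - z₀, ν z₀⟫ then p.2 else p.1)
      (g := fun z => gradient φ (z - z₀))
      (fun k => hBmeas.comp (by fun_prop)) ⟨C, fun k z => hC _⟩
      (Measurable.ite hHm measurable_const measurable_const)
      ⟨max ‖p.2‖ ‖p.1‖, fun z => by split_ifs <;> simp⟩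
      ((continuous_gradient hφ1).comp (by fun_prop))
      (hφc.gradient.comp_homeomorph (Homeomorph.subRight z₀)) hlim
    rw [integral_sub_right_eq_self
      (fun z => ⟪if 0 ≤ ⟪z, ν z₀⟫ then p.2 else p.1, gradient φ z⟫),
      integral_inner_ite_gradient _ _ _ hφ1 hφc] at hpair
    have hr' : Tendsto r atTop (𝓝[>] 0) :=
      tendsto_nhdsWithin_iff.mpr ⟨hr0, .of_forall hr⟩
    refine tendsto_nhds_unique hpair (((hc φ hφ hφc).comp hr').neg.congr fun k => ?_)
    have hscale := integral_inner_gradient_comp_smul_sub B (hφ1.differentiable one_ne_zero) z₀ (hr k)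
    rw [hdiv (fun z => φ ((r k)⁻¹ • (z - z₀))) (hφ.comp (by fun_prop)) ((hφc.comp_smul (inv_ne_zero (hr k).ne')).comp_homeomorph
      (Homeomorph.subRight z₀))] at hscale
    rw [← hscale, mul_neg]
    rfl
  intro p hp q hq
  rw [← sub_eq_zero, ← inner_sub_left]
  refine inner_eq_zero_of_setIntegral_halfspace_fderiv_eq_zero hν fun φ hφ hφc => ?_
  have hφ1 : ContDiff ℝ 1 φ := hφ.of_le (by exact_mod_cast le_top)
  have hint (d : EuclideanSpace ℝ (Fin n)) : Integrable fun z => fderiv ℝ φ z d :=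
    ((hφ1.continuous_fderiv one_ne_zero).clm_apply continuous_const).integrable_of_hasCompactSupport
      (hφc.fderiv_apply ℝ d)
  simp_rw [map_sub _ (p.2 - p.1) (q.2 - q.1)]
  rw [integral_sub (hint _).integrableOn (hint _).integrableOn, key p hp φ hφ hφc,
    key q hq φ hφ hφc, sub_self]
end
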